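/- For every integer α ≥ 1 there exists ε₀ > 0 such that for all ε with 0 < ε ≤ ε₀ the following holds in the geometric graph H_b(α, ε): every walk that starts at s, ends at t, and whose associated polygonal path is increasing-chord visits its vertices in strictly increasing order of y-coordinate (in particular, such a walk is a simple path and is y-monotone). -/

import Mathlib

open RealInnerProductSpace

noncomputable section

/-- The Euclidean plane `ℝ²`. -/
abbrev E2 : Type := EuclideanSpace ℝ (Fin 2)

/-- The point of `ℝ²` with coordinates `x`, `y`. -/
def pt (x y : ℝ) : E2 := (WithLp.equiv 2 (Fin 2 → ℝ)).symm ![x, y]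

/-- The piecewise-linear parametrization of the polygonal path with vertices
`v 0, v 1, …` : for `t ∈ [i, i+1]` it traverses the segment `[v i, v (i+1)]` linearly. -/
def polyPath (v : ℕ → E2) (t : ℝ) : E2 :=
  v ⌊t⌋₊ + (t - (⌊t⌋₊ : ℝ)) • (v (⌊t⌋₊ + 1) - v ⌊t⌋₊)

/-- The polygonal path with vertices `v 0, …, v n` is increasing-chord: for parameter
positions `a ⪯ b ⪯ c ⪯ d` in `[0, n]`, the distance between the points at `b` and `c`
is at most the distance between the points at `a` and `d`. -/
def IncreasingChord (n : ℕ) (v : ℕ → E2) : Prop :=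
  ∀ a b c d : ℝ, 0 ≤ a → a ≤ b → b ≤ c → c ≤ d → d ≤ (n : ℝ) →
    dist (polyPath v b) (polyPath v c) ≤ dist (polyPath v a) (polyPath v d)

/-- The slab of the segment `[x, y]`: points whose orthogonal projection onto the line
through `x` and `y` lies in the segment `[x, y]`. -/
def slab (x y : E2) : Set E2 :=
  {z | 0 ≤ ⟪z - x, y - x⟫ ∧ ⟪z - x, y - x⟫ ≤ ⟪y - x, y - x⟫}

/-- The point `p i = (2α + 1, −i²/(2α − i + 1))`, the intersection of `L i` with the
vertical line `x = 2α + 1`. -/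
def needleP (α i : ℕ) : E2 :=
  pt (2 * (α : ℝ) + 1) (-(i : ℝ) ^ 2 / (2 * (α : ℝ) - (i : ℝ) + 1))

/-- The point `p′ i = (2α + 1 − ε, −i²/(2α − i + 1) − ε(2α − i + 1)/i)`; the needle of
index `i` is the segment `[p i, p′ i]`, which is perpendicular to `L i`. -/
def needleP' (α : ℕ) (ε : ℝ) (i : ℕ) : E2 :=
  pt (2 * (α : ℝ) + 1 - ε)
    (-(i : ℝ) ^ 2 / (2 * (α : ℝ) - (i : ℝ) + 1) - ε * (2 * (α : ℝ) - (i : ℝ) + 1) / (i : ℝ))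

/-- The point `s = (2α + 1, −5α²)`, the bottom endpoint of the vertical segment `l_v`. -/
def sPt (α : ℕ) : E2 := pt (2 * (α : ℝ) + 1) (-(5 * (α : ℝ) ^ 2))

/-- The point `t = (2α + 1, 0)`, where `l_v` meets the `x`-axis. -/
def tPt (α : ℕ) : E2 := pt (2 * (α : ℝ) + 1) 0

/-- The edges of the geometric graph `H_b(α, ε)`, given in one orientation:
the needles `[p i, p′ i]` for `1 ≤ i ≤ 2α`; for `2 ≤ k ≤ α` the four edges joining each
of `p (2k−1)`, `p (2k)` to each of `p′ (2k−3)`, `p′ (2k−2)`; the edges from `s` to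
`p′ (2α−1)` and `p′ (2α)`; and the edges from `t` to `p 1` and `p 2`. -/
def HbAdjAux (α : ℕ) (ε : ℝ) (x y : E2) : Prop :=
  (∃ i : ℕ, 1 ≤ i ∧ i ≤ 2 * α ∧ x = needleP α i ∧ y = needleP' α ε i) ∨
  (∃ k : ℕ, 2 ≤ k ∧ k ≤ α ∧
    (x = needleP α (2 * k - 1) ∨ x = needleP α (2 * k)) ∧
    (y = needleP' α ε (2 * k - 3) ∨ y = needleP' α ε (2 * k - 2))) ∨
  (x = sPt α ∧ (y = needleP' α ε (2 * α - 1) ∨ y = needleP' α ε (2 * α))) ∨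
  (x = tPt α ∧ (y = needleP α 1 ∨ y = needleP α 2))

/-- `x` and `y` are joined by an edge of the geometric graph `H_b(α, ε)`. -/
def HbEdge (α : ℕ) (ε : ℝ) (x y : E2) : Prop :=
  HbAdjAux α ε x y ∨ HbAdjAux α ε y x

/-- `w 0, w 1, …, w m` is a walk in `H_b(α, ε)` from `s` to `t`: it starts at `s`,
ends at `t`, and consecutive vertices are joined by an edge of `H_b(α, ε)`. -/
def IsHbWalk (α : ℕ) (ε : ℝ) (m : ℕ) (w : ℕ → E2) : Prop :=
  w 0 = sPt α ∧ w m = tPt α ∧ ∀ k < m, HbEdge α ε (w k) (w (k + 1))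

/-- `x` lies strictly below `y` and strictly farther from `t` than `y`. -/
def Ascends (α : ℕ) (x y : E2) : Prop :=
  x 1 < y 1 ∧ dist y (tPt α) < dist x (tPt α)

/-- The depth `i²/(2α − i + 1)` of the needle point `p i` below `t`. -/
def needleDepth (α i : ℕ) : ℝ := (i : ℝ) ^ 2 / (2 * (α : ℝ) - (i : ℝ) + 1)

/-- The slope `(2α − i + 1)/i` of the needle of index `i`. -/
def needleSlope (α i : ℕ) : ℝ := (2 * (α : ℝ) - (i : ℝ) + 1) / (i : ℝ)

lemma needleP_eq (α i : ℕ) :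
    needleP α i = pt (2 * (α : ℝ) + 1 - 0) (-needleDepth α i) := by
  simp [needleP, needleDepth, neg_div]

lemma needleP'_eq (α : ℕ) (ε : ℝ) (i : ℕ) :
    needleP' α ε i
      = pt (2 * (α : ℝ) + 1 - ε) (-(needleDepth α i + ε * needleSlope α i)) := by
  simp only [needleP', needleDepth, needleSlope]
  congr 1
  ring

lemma sPt_eq (α : ℕ) : sPt α = pt (2 * (α : ℝ) + 1 - 0) (-(5 * (α : ℝ) ^ 2)) := by
  simp [sPt]

lemma tPt_eq (α : ℕ) : tPt α = pt (2 * (α : ℝ) + 1 - 0) (-0) := by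
  simp [tPt]

lemma polyPath_natCast (v : ℕ → E2) (k : ℕ) : polyPath v k = v k := by
  simp [polyPath]

lemma ascends_pt {α : ℕ} {a b c d : ℝ} (hy : d < b) (hd : c ^ 2 + d ^ 2 < a ^ 2 + b ^ 2) :
    Ascends α (pt (2 * (α : ℝ) + 1 - a) (-b)) (pt (2 * (α : ℝ) + 1 - c) (-d)) := by
  refine ⟨by simpa [pt] using hy, ?_⟩
  rw [EuclideanSpace.dist_eq, EuclideanSpace.dist_eq]
  apply Real.sqrt_lt_sqrt (by positivity)
  simpa [Fin.sum_univ_two, pt, tPt, Real.dist_eq, sq_abs] using hd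

/-- A point on the vertical line through `t` ascends to any point displaced horizontally
by less than their height difference. -/
lemma ascends_pt_of_lt_sub {α : ℕ} {ε b d : ℝ} (hε : 0 ≤ ε) (hd : 0 ≤ d) (h : ε < b - d) :
    Ascends α (pt (2 * (α : ℝ) + 1 - 0) (-b)) (pt (2 * (α : ℝ) + 1 - ε) (-d)) :=
  ascends_pt (by linarith) (by nlinarith)

lemma needleDepth_pos {α i : ℕ} (hi : 1 ≤ i) (hiα : i ≤ 2 * α) : 0 < needleDepth α i := by
  have h1 : (1 : ℝ) ≤ i := by exact_mod_cast hi
  have h2 : (i : ℝ) ≤ 2 * α := by exact_mod_cast hiα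
  have : 0 < 2 * (α : ℝ) - i + 1 := by linarith
  unfold needleDepth
  positivity

lemma needleDepth_le {α i : ℕ} (hiα : i ≤ 2 * α) :
    needleDepth α i ≤ 4 * (α : ℝ) ^ 2 := by
  have h1 : (0 : ℝ) ≤ i := by positivity
  have h2 : (i : ℝ) ≤ 2 * α := by exact_mod_cast hiα
  unfold needleDepth
  rw [div_le_iff₀ (by linarith)]
  nlinarith

lemma div_le_needleDepth_sub {α i j : ℕ} (hj : 1 ≤ j) (hji : j < i) (hiα : i ≤ 2 * α) :
    3 / (2 * (α : ℝ)) ≤ needleDepth α i - needleDepth α j := by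
  have h1 : (1 : ℝ) ≤ j := by exact_mod_cast hj
  have h2 : (j : ℝ) + 1 ≤ i := by exact_mod_cast hji
  have h3 : (i : ℝ) ≤ 2 * α := by exact_mod_cast hiα
  have hj0 : 0 < 2 * (α : ℝ) - j + 1 := by linarith
  calc 3 / (2 * (α : ℝ)) ≤ ((i : ℝ) ^ 2 - (j : ℝ) ^ 2) / (2 * (α : ℝ) - j + 1) :=
        div_le_div₀ (by nlinarith) (by nlinarith) hj0 (by linarith)
    _ = (i : ℝ) ^ 2 / (2 * (α : ℝ) - j + 1) - needleDepth α j := by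
        rw [needleDepth, sub_div]
    _ ≤ needleDepth α i - needleDepth α j := by
        unfold needleDepth
        gcongr

lemma needleSlope_pos {α i : ℕ} (hi : 1 ≤ i) (hiα : i ≤ 2 * α) : 0 < needleSlope α i := by
  have h1 : (1 : ℝ) ≤ i := by exact_mod_cast hi
  have h2 : (i : ℝ) ≤ 2 * α := by exact_mod_cast hiα
  exact div_pos (by linarith) (by linarith)

lemma needleSlope_le {α i : ℕ} (hi : 1 ≤ i) : needleSlope α i ≤ 2 * (α : ℝ) := by
  have h1 : (1 : ℝ) ≤ i := by exact_mod_cast hi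
  have h2 : (0 : ℝ) ≤ α := by positivity
  unfold needleSlope
  rw [div_le_iff₀ (by linarith)]
  nlinarith

section Edges

variable {α : ℕ} {ε : ℝ}

lemma mul_needleSlope_add_lt (hα : 1 ≤ α) (hε : 0 < ε) (hε' : ε ≤ 1 / (4 * (α : ℝ) ^ 2))
    {j : ℕ} (hj : 1 ≤ j) : ε * needleSlope α j + ε < 1 / α := by
  have h1 : (1 : ℝ) ≤ α := by exact_mod_cast hα
  have h2 := needleSlope_le (α := α) hj
  have h3 : ε * (needleSlope α j + 1) ≤ ε * (3 * α) := by gcongr; linarith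
  rw [le_div_iff₀ (by positivity)] at hε'
  rw [lt_div_iff₀ (by positivity)]
  nlinarith

lemma ascends_needle (hε : 0 < ε) {i : ℕ} (hi : 1 ≤ i) (hiα : i ≤ 2 * α) :
    Ascends α (needleP' α ε i) (needleP α i) := by
  have hd := needleDepth_pos hi hiα
  have hs := mul_pos hε (needleSlope_pos hi hiα)
  rw [needleP_eq, needleP'_eq]
  exact ascends_pt (by linarith) (by nlinarith)

lemma ascends_link (hα : 1 ≤ α) (hε : 0 < ε) (hε' : ε ≤ 1 / (4 * (α : ℝ) ^ 2)) {i j : ℕ}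
    (hj : 1 ≤ j) (hji : j < i) (hiα : i ≤ 2 * α) :
    Ascends α (needleP α i) (needleP' α ε j) := by
  have h1 : (0 : ℝ) < α := by exact_mod_cast hα
  have hd := needleDepth_pos hj (hji.le.trans hiα)
  have hs := mul_pos hε (needleSlope_pos hj (hji.le.trans hiα))
  have hgap := div_le_needleDepth_sub hj hji hiα
  have hlt_inv := mul_needleSlope_add_lt hα hε hε' hj
  have hlt : 1 / (α : ℝ) < 3 / (2 * (α : ℝ)) := by
    rw [div_lt_div_iff₀ h1 (by linarith)]
    linarith
  rw [needleP_eq, needleP'_eq]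
  exact ascends_pt_of_lt_sub hε.le (by linarith) (by linarith)

lemma ascends_source (hα : 1 ≤ α) (hε : 0 < ε) (hε' : ε ≤ 1 / (4 * (α : ℝ) ^ 2)) {j : ℕ}
    (hj : 1 ≤ j) (hjα : j ≤ 2 * α) : Ascends α (sPt α) (needleP' α ε j) := by
  have h1 : (1 : ℝ) ≤ α := by exact_mod_cast hα
  have hd := needleDepth_pos hj hjα
  have hd' := needleDepth_le hjα
  have hs := mul_pos hε (needleSlope_pos hj hjα)
  rw [sPt_eq, needleP'_eq]
  have hlt_inv := mul_needleSlope_add_lt hα hε hε' hj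
  have hlt : ε < 5 * (α : ℝ) ^ 2 - (needleDepth α j + ε * needleSlope α j) := by
    have h2 : 1 / (α : ℝ) ≤ 1 := (div_le_one (by linarith)).2 h1
    nlinarith
  exact ascends_pt_of_lt_sub hε.le (by linarith) hlt

lemma ascends_target {i : ℕ} (hi : 1 ≤ i) (hiα : i ≤ 2 * α) :
    Ascends α (needleP α i) (tPt α) := by
  have hd := needleDepth_pos hi hiα
  rw [needleP_eq, tPt_eq]
  exact ascends_pt_of_lt_sub le_rfl le_rfl (by linarith)

lemma HbAdjAux.ascends_or_ascends (hα : 1 ≤ α) (hε : 0 < ε)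
    (hε' : ε ≤ 1 / (4 * (α : ℝ) ^ 2)) {x y : E2} (h : HbAdjAux α ε x y) :
    Ascends α x y ∨ Ascends α y x := by
  rcases h with ⟨i, hi, hiα, rfl, rfl⟩ | ⟨k, hk, hkα, rfl | rfl, rfl | rfl⟩ |
    ⟨rfl, rfl | rfl⟩ | ⟨rfl, rfl | rfl⟩
  · exact .inr (ascends_needle hε hi hiα)
  iterate 4 exact .inl (ascends_link hα hε hε' (by omega) (by omega) (by omega))
  iterate 2 exact .inl (ascends_source hα hε hε' (by omega) (by omega))
  iterate 2 exact .inr (ascends_target (by omega) (by omega))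

end Edges

/-- For every integer `α ≥ 1` there is `ε₀ > 0` such that for all
`0 < ε ≤ ε₀`: every walk in `H_b(α, ε)` from `s` to `t` whose associated polygonal path
is increasing-chord visits its vertices in strictly increasing order of `y`-coordinate
(in particular, it is a simple, `y`-monotone path). -/
theorem increasingChord_walk_y_strict_mono :
    ∀ α : ℕ, 1 ≤ α → ∃ ε₀ : ℝ, 0 < ε₀ ∧ ∀ ε : ℝ, 0 < ε → ε ≤ ε₀ →
      ∀ (m : ℕ) (w : ℕ → E2), IsHbWalk α ε m w → IncreasingChord m w →
        ∀ k l : ℕ, k < l → l ≤ m → (w k) 1 < (w l) 1 := by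
  intro α hα
  have h1 : (0 : ℝ) < α := by exact_mod_cast hα
  refine ⟨1 / (4 * (α : ℝ) ^ 2), by positivity, fun ε hε hε' m w ⟨_, ht, hw⟩ hic ↦ ?_⟩
  have step : ∀ k < m, (w k) 1 < (w (k + 1)) 1 := by
    intro k hk
    have hdist : dist (w (k + 1)) (tPt α) ≤ dist (w k) (tPt α) := by
      have := hic k (k + 1 : ℕ) m m (by positivity) (by simp) (by exact_mod_cast hk)
        le_rfl le_rfl
      simpa only [polyPath_natCast, ht] using this
    have hasc : Ascends α (w k) (w (k + 1)) ∨ Ascends α (w (k + 1)) (w k) :=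
      (hw k hk).elim (·.ascends_or_ascends hα hε hε')
        fun h ↦ (h.ascends_or_ascends hα hε hε').symm
    exact hasc.elim (·.1) fun h ↦ absurd h.2 hdist.not_gt
  intro k l hkl
  induction l, hkl using Nat.le_induction with
  | base => exact fun hl ↦ step k hl
  | succ l _ ih => exact fun hl ↦ (ih (by omega)).trans (step l hl)
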